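/- arXiv:2507.21511 — 9 statements merged into one kernel-verified Lean document; each statement's English description precedes it below -/
import Mathlib

section
/- Every 4D rotation matrix factors through a pair of unit quaternions: for every real 4×4 matrix Z satisfying Zᵀ·Z = I₄ and det Z = 1, there exist real numbers a, b, c, d, p, q, r, s with a² + b² + c² + d² = 1 and p² + q² + r² + s² = 1 such that Z = M_L(a,b,c,d) · M_R(p,q,r,s). -/
open Matrix

noncomputable def ML (a b c d : ℝ) : Matrix (Fin 4) (Fin 4) ℝ :=
  !![a, -b, -c, -d;
     b,  a, -d,  c;
     c,  d,  a, -b;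
     d, -c,  b,  a]

noncomputable def MR (p q r s : ℝ) : Matrix (Fin 4) (Fin 4) ℝ :=
  !![p, -q, -r, -s;
     q,  p,  s, -r;
     r, -s,  p,  q;
     s,  r, -q,  p]

open scoped Quaternion InnerProductSpace

theorem Quaternion.mul_star_mul_self (u x : ℍ[ℝ]) :
    u * star x * u = (2 * ⟪u, x⟫_ℝ) • u - (‖u‖ ^ 2) • x := by
  rw [sq, ← Quaternion.normSq_eq_norm_mul_self, Quaternion.normSq_def', Quaternion.inner_def]
  ext <;> simp <;> ring

theorem Quaternion.exists_reflection_eq (v : ℍ[ℝ]) (hv : v ≠ 0) :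
    ∃ u : ℍ[ℝ], ‖u‖ = 1 ∧ ∀ x, (ℝ ∙ v)ᗮ.reflection x = -(u * star x * u) := by
  have hn : ‖v‖ ≠ 0 := norm_ne_zero_iff.mpr hv
  refine ⟨‖v‖⁻¹ • v, by rw [norm_smul, norm_inv, norm_norm, inv_mul_cancel₀ hn], fun x => ?_⟩
  rw [Submodule.reflection_orthogonal_apply, Submodule.reflection_singleton_apply]
  have h := Quaternion.mul_star_mul_self v x
  simp only [smul_mul_assoc, mul_smul_comm, h, smul_sub, smul_smul, two_smul]
  congr 1
  congr 1
  · rw [← add_smul]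
    congr 1
    simp
    field_simp
    ring
  · rw [show ‖v‖⁻¹ * (‖v‖⁻¹ * ‖v‖ ^ 2) = 1 by field_simp, one_smul]

theorem Quaternion.linearIsometryEquiv_eq_mul (φ : ℍ[ℝ] ≃ₗᵢ[ℝ] ℍ[ℝ]) :
    ∃ a b : ℍ[ℝ], ‖a‖ = 1 ∧ ‖b‖ = 1 ∧
      ((∀ x, φ x = a * x * b) ∨ ∀ x, φ x = a * star x * b) := by
  obtain ⟨l, -, rfl⟩ := φ.reflections_generate_dim
  induction l with
  | nil => exact ⟨1, 1, norm_one, norm_one, .inl fun x => by simp⟩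
  | cons v l ih =>
    obtain ⟨a, b, ha, hb, h⟩ := ih
    by_cases hv : v = 0
    · refine ⟨a, b, ha, hb, ?_⟩
      have hr (x : ℍ[ℝ]) : (ℝ ∙ v)ᗮ.reflection x = x :=
        Submodule.reflection_mem_subspace_eq_self (by simp [hv])
      simpa only [List.map_cons, List.prod_cons, LinearIsometryEquiv.coe_mul, Function.comp_apply,
        hr] using h
    obtain ⟨u, hu, hr⟩ := Quaternion.exists_reflection_eq v hv
    refine ⟨-(u * star b), star a * u, by simp [hu, hb], by simp [hu, ha], ?_⟩
    simp only [List.map_cons, List.prod_cons, LinearIsometryEquiv.coe_mul,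
      Function.comp_apply, hr]
    rcases h with h | h
    · right
      intro x
      simp [h, mul_assoc]
    · left
      intro x
      simp [h, mul_assoc]

theorem ML_mul_MR_mulVec (a b x : ℍ[ℝ]) :
    (ML a.re a.imI a.imJ a.imK * MR b.re b.imI b.imJ b.imK) *ᵥ ![x.re, x.imI, x.imJ, x.imK] =
      ![(a * x * b).re, (a * x * b).imI, (a * x * b).imJ, (a * x * b).imK] := by
  rw [← Matrix.mulVec_mulVec]
  ext i
  fin_cases i <;> simp [ML, MR, Matrix.mulVec, dotProduct, Fin.sum_univ_four] <;> ring

theorem det_ML (a b c d : ℝ) : (ML a b c d).det = (a ^ 2 + b ^ 2 + c ^ 2 + d ^ 2) ^ 2 := by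
  simp [ML, Matrix.det_succ_row_zero, Fin.sum_univ_succ, Fin.succAbove]
  ring

theorem det_MR (p q r s : ℝ) : (MR p q r s).det = (p ^ 2 + q ^ 2 + r ^ 2 + s ^ 2) ^ 2 := by
  simp [MR, Matrix.det_succ_row_zero, Fin.sum_univ_succ, Fin.succAbove]
  ring

theorem Quaternion.sum_sq_eq_one {a : ℍ[ℝ]} (ha : ‖a‖ = 1) :
    a.re ^ 2 + a.imI ^ 2 + a.imJ ^ 2 + a.imK ^ 2 = 1 := by
  rw [← Quaternion.normSq_def', Quaternion.normSq_eq_norm_mul_self, ha, one_mul]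

/-- The linear isometry of the quaternions whose matrix in the basis `1, i, j, k` is `Z`. -/
theorem exists_quaternion_linearIsometryEquiv (Z : Matrix (Fin 4) (Fin 4) ℝ) (hZ : Zᵀ * Z = 1) :
    ∃ φ : ℍ[ℝ] ≃ₗᵢ[ℝ] ℍ[ℝ], ∀ x,
      ![(φ x).re, (φ x).imI, (φ x).imJ, (φ x).imK] = Z *ᵥ ![x.re, x.imI, x.imJ, x.imK] := by
  let f : EuclideanSpace ℝ (Fin 4) →ₗᵢ[ℝ] EuclideanSpace ℝ (Fin 4) :=
    (Matrix.toEuclideanLin Z).isometryOfInner fun x y => by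
      simp only [EuclideanSpace.inner_eq_star_dotProduct, Matrix.ofLp_toLpLin,
        Matrix.toLin'_apply, star_trivial]
      rw [Matrix.dotProduct_mulVec, ← Matrix.mulVec_transpose, Matrix.mulVec_mulVec, hZ,
        Matrix.one_mulVec]
  let e := Quaternion.linearIsometryEquivTuple
  refine ⟨e.trans ((f.toLinearIsometryEquiv rfl).trans e.symm), fun x => ?_⟩
  ext i
  fin_cases i <;> rfl

theorem Matrix.eq_of_mulVec_quaternion {A B : Matrix (Fin 4) (Fin 4) ℝ}
    (h : ∀ x : ℍ[ℝ], A *ᵥ ![x.re, x.imI, x.imJ, x.imK] = B *ᵥ ![x.re, x.imI, x.imJ, x.imK]) :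
    A = B := by
  refine Matrix.ext_of_mulVec_single fun i => ?_
  have hv (v : Fin 4 → ℝ) : ![v 0, v 1, v 2, v 3] = v := by
    ext j
    fin_cases j <;> rfl
  rw [← hv (Pi.single i 1)]
  exact h ⟨_, _, _, _⟩

theorem rotation4D_factors_through_unit_quaternions
    (Z : Matrix (Fin 4) (Fin 4) ℝ) (hZ : Zᵀ * Z = 1) (hdet : Z.det = 1) :
    ∃ a b c d p q r s : ℝ,
      a ^ 2 + b ^ 2 + c ^ 2 + d ^ 2 = 1 ∧
      p ^ 2 + q ^ 2 + r ^ 2 + s ^ 2 = 1 ∧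
      Z = ML a b c d * MR p q r s := by
  obtain ⟨φ, hφ⟩ := exists_quaternion_linearIsometryEquiv Z hZ
  obtain ⟨a, b, ha, hb, h⟩ := Quaternion.linearIsometryEquiv_eq_mul φ
  have ha' := Quaternion.sum_sq_eq_one ha
  have hb' := Quaternion.sum_sq_eq_one hb
  rcases h with h | h
  · refine ⟨_, _, _, _, _, _, _, _, ha', hb', Matrix.eq_of_mulVec_quaternion fun x => ?_⟩
    rw [← hφ, h, ML_mul_MR_mulVec]
  · have hD : Z = ML a.re a.imI a.imJ a.imK * MR b.re b.imI b.imJ b.imK *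
        Matrix.diagonal ![1, -1, -1, -1] := by
      refine Matrix.eq_of_mulVec_quaternion fun x => ?_
      have hs : ![(star x).re, (star x).imI, (star x).imJ, (star x).imK] =
          Matrix.diagonal ![1, -1, -1, -1] *ᵥ ![x.re, x.imI, x.imJ, x.imK] := by
        ext i
        fin_cases i <;> simp [Matrix.mulVec_diagonal]
      rw [← hφ, h, ← ML_mul_MR_mulVec, hs, Matrix.mulVec_mulVec]
    rw [hD, Matrix.det_mul, Matrix.det_mul, det_ML, det_MR, ha', hb', Matrix.det_diagonal] at hdet
    simp [Fin.prod_univ_succ] at hdet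
    norm_num at hdet
end

section
/- For all real numbers α₁, α₂, the rotation matrix of the 2D separable fractional Fourier transform factors as R⁴ᴰ_S(α₁,α₂) = M_L(cos((α₁−α₂)/2), 0, sin((α₁−α₂)/2), 0) · M_R(cos((α₁+α₂)/2), 0, sin((α₁+α₂)/2), 0). -/
open Matrix Real

noncomputable def R4DS (α₁ α₂ : ℝ) : Matrix (Fin 4) (Fin 4) ℝ :=
  !![Real.cos α₁, 0, -Real.sin α₁, 0;
     0, Real.cos α₂, 0, -Real.sin α₂;
     Real.sin α₁, 0, Real.cos α₁, 0;
     0, Real.sin α₂, 0, Real.cos α₂]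

theorem R4DS_factorization (α₁ α₂ : ℝ) :
    R4DS α₁ α₂ =
      ML (Real.cos ((α₁ - α₂) / 2)) 0 (Real.sin ((α₁ - α₂) / 2)) 0 *
      MR (Real.cos ((α₁ + α₂) / 2)) 0 (Real.sin ((α₁ + α₂) / 2)) 0 := by
  have h₁ : α₁ = (α₁ - α₂) / 2 + (α₁ + α₂) / 2 := by ring
  have h₂ : α₂ = (α₁ + α₂) / 2 - (α₁ - α₂) / 2 := by ring
  generalize (α₁ - α₂) / 2 = u at *
  generalize (α₁ + α₂) / 2 = v at *
  subst h₁ h₂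
  ext i j
  fin_cases i <;> fin_cases j <;>
    simp [R4DS, ML, MR, Matrix.mul_apply, Fin.sum_univ_four, Real.cos_add, Real.sin_add,
      Real.cos_sub, Real.sin_sub] <;>
    ring
end

section
/- For all real numbers a, b, c, d, θ with a² + b² + c² + d² = 1, the matrix R⁴ᴰ_NS(a,b,c,d,θ) is a 4D rotation matrix, i.e. R⁴ᴰ_NS(a,b,c,d,θ)ᵀ · R⁴ᴰ_NS(a,b,c,d,θ) = I₄ and det R⁴ᴰ_NS(a,b,c,d,θ) = 1. -/
open Matrix Real

noncomputable def R4DNS (a b c d θ : ℝ) : Matrix (Fin 4) (Fin 4) ℝ :=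
  !![a * Real.cos θ - c * Real.sin θ, -(b * Real.cos θ) - d * Real.sin θ, -(a * Real.sin θ) - c * Real.cos θ, b * Real.sin θ - d * Real.cos θ;
     b * Real.cos θ - d * Real.sin θ, a * Real.cos θ + c * Real.sin θ, -(b * Real.sin θ) - d * Real.cos θ, -(a * Real.sin θ) + c * Real.cos θ;
     a * Real.sin θ + c * Real.cos θ, -(b * Real.sin θ) + d * Real.cos θ, a * Real.cos θ - c * Real.sin θ, -(b * Real.cos θ) - d * Real.sin θ;
     b * Real.sin θ + d * Real.cos θ, a * Real.sin θ - c * Real.cos θ, b * Real.cos θ - d * Real.sin θ, a * Real.cos θ + c * Real.sin θ]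

theorem R4DNS_transpose_mul_self (a b c d θ : ℝ) :
    (R4DNS a b c d θ)ᵀ * R4DNS a b c d θ =
      ((cos θ ^ 2 + sin θ ^ 2) * (a ^ 2 + b ^ 2 + c ^ 2 + d ^ 2)) • 1 := by
  ext i j
  fin_cases i <;> fin_cases j <;>
    simp [R4DNS, Matrix.mul_apply, Fin.sum_univ_four, -cos_sq_add_sin_sq] <;> ring

theorem det_R4DNS (a b c d θ : ℝ) :
    (R4DNS a b c d θ).det =
      ((cos θ ^ 2 + sin θ ^ 2) * (a ^ 2 + b ^ 2 + c ^ 2 + d ^ 2)) ^ 2 := by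
  simp [R4DNS, Matrix.det_succ_row_zero, Fin.sum_univ_succ, Fin.succAbove,
    -cos_sq_add_sin_sq]
  ring

theorem R4DNS_is_rotation4D (a b c d θ : ℝ)
    (h : a ^ 2 + b ^ 2 + c ^ 2 + d ^ 2 = 1) :
    (R4DNS a b c d θ)ᵀ * R4DNS a b c d θ = 1 ∧ (R4DNS a b c d θ).det = 1 := by
  rw [R4DNS_transpose_mul_self, det_R4DNS, cos_sq_add_sin_sq, h]
  simp
end

section
/- For all real numbers a, b, c, d, θ with a² + b² + c² + d² = 1, the 2×2 blocks A(a,b,c,d,θ) and B(a,b,c,d,θ) of the 2D nonseparable FRFT parameter matrix satisfy Aᵀ·A + Bᵀ·B = I₂ and Aᵀ·B = Bᵀ·A; consequently the 4×4 block matrix X = [[A, B],[−B, A]] satisfies Xᵀ·X = I₄. -/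
open Matrix Real

noncomputable def Ablk (a b c d θ : ℝ) : Matrix (Fin 2) (Fin 2) ℝ :=
  !![a * Real.cos θ - c * Real.sin θ, b * Real.cos θ - d * Real.sin θ;
     -(b * Real.cos θ) - d * Real.sin θ, a * Real.cos θ + c * Real.sin θ]

noncomputable def Bblk (a b c d θ : ℝ) : Matrix (Fin 2) (Fin 2) ℝ :=
  !![a * Real.sin θ + c * Real.cos θ, b * Real.sin θ + d * Real.cos θ;
     -(b * Real.sin θ) + d * Real.cos θ, a * Real.sin θ - c * Real.cos θ]

theorem nsfrft_blocks_orthogonality (a b c d θ : ℝ)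
    (h : a ^ 2 + b ^ 2 + c ^ 2 + d ^ 2 = 1) :
    (Ablk a b c d θ)ᵀ * Ablk a b c d θ + (Bblk a b c d θ)ᵀ * Bblk a b c d θ = 1 ∧
    (Ablk a b c d θ)ᵀ * Bblk a b c d θ = (Bblk a b c d θ)ᵀ * Ablk a b c d θ ∧
    (Matrix.fromBlocks (Ablk a b c d θ) (Bblk a b c d θ)
        (-(Bblk a b c d θ)) (Ablk a b c d θ))ᵀ *
      Matrix.fromBlocks (Ablk a b c d θ) (Bblk a b c d θ)
        (-(Bblk a b c d θ)) (Ablk a b c d θ) = 1 := by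
  have hcs := Real.cos_sq_add_sin_sq θ
  have h₁ : (Ablk a b c d θ)ᵀ * Ablk a b c d θ + (Bblk a b c d θ)ᵀ * Bblk a b c d θ = 1 := by
    ext i j
    fin_cases i <;> fin_cases j <;>
      simp [Ablk, Bblk, Matrix.mul_apply, Fin.sum_univ_two]
    · linear_combination (Real.cos θ ^ 2 + Real.sin θ ^ 2) * h + hcs
    · ring
    · ring
    · linear_combination (Real.cos θ ^ 2 + Real.sin θ ^ 2) * h + hcs
  have h₂ : (Ablk a b c d θ)ᵀ * Bblk a b c d θ = (Bblk a b c d θ)ᵀ * Ablk a b c d θ := by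
    ext i j
    fin_cases i <;> fin_cases j <;>
      simp [Ablk, Bblk, Matrix.mul_apply, Fin.sum_univ_two] <;> ring
  refine ⟨h₁, h₂, ?_⟩
  rw [Matrix.fromBlocks_transpose, Matrix.fromBlocks_multiply, ← Matrix.fromBlocks_one]
  simp only [Matrix.transpose_neg, neg_mul, mul_neg, neg_neg]
  rw [h₁, h₂, add_comm ((Bblk a b c d θ)ᵀ * Bblk a b c d θ), h₁]
  simp only [add_neg_cancel]
end

section
/- Let A and B be real 2×2 matrices with B invertible, Aᵀ·A + Bᵀ·B = I₂, and Aᵀ·B = Bᵀ·A. Then the 4×4 block matrix [[A, B],[−B, A]] admits the decomposition [[A, B],[−B, A]] = [[I₂, 0],[A·B⁻¹, I₂]] · [[0, I₂],[−I₂, 0]] · [[(Bᵀ)⁻¹, 0],[0, B]] · [[I₂, 0],[B⁻¹·A, I₂]]. -/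
open Matrix

theorem nsfrft_decomposition_algorithm_one
    (A B : Matrix (Fin 2) (Fin 2) ℝ)
    (hB : IsUnit B)
    (h1 : Aᵀ * A + Bᵀ * B = 1)
    (h2 : Aᵀ * B = Bᵀ * A) :
    Matrix.fromBlocks A B (-B) A =
      Matrix.fromBlocks 1 0 (A * B⁻¹) 1 *
      Matrix.fromBlocks 0 1 (-1) 0 *
      Matrix.fromBlocks (Bᵀ)⁻¹ 0 0 B *
      Matrix.fromBlocks 1 0 (B⁻¹ * A) 1 := by
  have hdet : IsUnit B.det := (Matrix.isUnit_iff_isUnit_det B).mp hB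
  have hBA : B * (B⁻¹ * A) = A := Matrix.mul_nonsing_inv_cancel_left B A hdet
  have hAB : A * B⁻¹ * B = A := Matrix.nonsing_inv_mul_cancel_right B A hdet
  have hinv : (Bᵀ)⁻¹ = B + A * (B⁻¹ * A) := by
    apply Matrix.inv_eq_right_inv
    rw [mul_add, ← mul_assoc Bᵀ A, ← h2, mul_assoc, hBA, add_comm, h1]
  have hC : -B = -(Bᵀ)⁻¹ + A * (B⁻¹ * A) := by
    rw [hinv]
    abel
  simp only [Matrix.fromBlocks_multiply, one_mul, zero_mul, mul_zero, mul_one, zero_add,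
    add_zero, mul_neg, neg_mul, neg_zero, hBA, hAB, ← hC]
end

section
/- Let A and B be real 2×2 matrices with B invertible and symmetric (B = Bᵀ), Aᵀ·A + Bᵀ·B = I₂, and Aᵀ·B = Bᵀ·A. Then the 4×4 block matrix [[A, B],[−B, A]] admits the interpolation-free decomposition [[A, B],[−B, A]] = [[I₂, 0],[(A − I₂)·B⁻¹, I₂]] · [[I₂, B],[0, I₂]] · [[I₂, 0],[B⁻¹·(A − I₂), I₂]]. -/
open Matrix

theorem nsfrft_decomposition_algorithm_two
    (A B : Matrix (Fin 2) (Fin 2) ℝ)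
    (hB : IsUnit B)
    (hBsymm : B = Bᵀ)
    (h1 : Aᵀ * A + Bᵀ * B = 1)
    (h2 : Aᵀ * B = Bᵀ * A) :
    Matrix.fromBlocks A B (-B) A =
      Matrix.fromBlocks 1 0 ((A - 1) * B⁻¹) 1 *
      Matrix.fromBlocks 1 B 0 1 *
      Matrix.fromBlocks 1 0 (B⁻¹ * (A - 1)) 1 := by
  have hdet : IsUnit B.det := (Matrix.isUnit_iff_isUnit_det B).mp hB
  have hl : B⁻¹ * B = 1 := Matrix.nonsing_inv_mul B hdet
  have hr : B * B⁻¹ = 1 := Matrix.mul_nonsing_inv B hdet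
  rw [← hBsymm] at h1 h2
  have hAT : Aᵀ = B * A * B⁻¹ := by rw [← h2, mul_assoc, hr, mul_one]
  have hABA : A * B⁻¹ * A + B = B⁻¹ := by
    calc A * B⁻¹ * A + B = B⁻¹ * B * (A * B⁻¹ * A) + B⁻¹ * B * B := by simp [hl]
      _ = B⁻¹ * (B * A * B⁻¹ * A + B * B) := by noncomm_ring
      _ = B⁻¹ := by rw [← hAT, h1, mul_one]
  have hCB : (A - 1) * B⁻¹ * B = A - 1 := by rw [mul_assoc, hl, mul_one]
  have hBC : B * (B⁻¹ * (A - 1)) = A - 1 := by rw [← mul_assoc, hr, one_mul]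
  have hlower : (A - 1) * B⁻¹ + A * (B⁻¹ * (A - 1)) = -B := by
    calc (A - 1) * B⁻¹ + A * (B⁻¹ * (A - 1)) = A * B⁻¹ * A + B - B⁻¹ - B := by noncomm_ring
      _ = -B := by rw [hABA, sub_self, zero_sub]
  simp only [Matrix.fromBlocks_multiply, mul_one, one_mul, mul_zero, add_zero,
    zero_add, hCB, hBC, sub_add_cancel, add_sub_cancel, hlower]
end

section
/- Inversion formula for the 2D nonseparable fractional Fourier transform: let a, b, c, d, θ be real numbers with a² + b² + c² + d² = 1 and T ≠ 0, and let f : ℝ² → ℂ be a Schwartz function. Then for all (x, y) ∈ ℝ², ∫_{ℝ²} F_P(u,v) · conj(K_P(x,y,u,v)) du dv = f(x,y), where F_P(u,v) = ∫_{ℝ²} f(x,y) K_P(x,y,u,v) dx dy. -/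
open Real Complex MeasureTheory

noncomputable def nsT (a b c d θ : ℝ) : ℝ :=
  a ^ 2 * Real.sin θ ^ 2 + b ^ 2 * Real.sin θ ^ 2
    - c ^ 2 * Real.cos θ ^ 2 - d ^ 2 * Real.cos θ ^ 2

/-- The kernel of the 2D nonseparable fractional Fourier transform. -/
noncomputable def nsKernel (a b c d θ : ℝ) (x y u v : ℝ) : ℂ :=
  let T : ℝ := nsT a b c d θ
  let p₁ : ℝ := Real.sin θ * Real.cos θ - a * c + b * d
  let p₂ : ℝ := -2 * (b * c + a * d)
  let p₃ : ℝ := Real.sin θ * Real.cos θ + a * c - b * d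
  let m₁ : ℝ := -a * Real.sin θ + c * Real.cos θ
  let m₂ : ℝ := b * Real.sin θ + d * Real.cos θ
  let m₃ : ℝ := -b * Real.sin θ + d * Real.cos θ
  let m₄ : ℝ := -a * Real.sin θ - c * Real.cos θ
  let k₁ : ℝ := Real.sin θ * Real.cos θ - a * c - b * d
  let k₂ : ℝ := 2 * (b * c - a * d)
  let k₃ : ℝ := Real.sin θ * Real.cos θ + a * c + b * d
  (1 / (2 * (Real.pi : ℂ) * ((-(T : ℂ)) ^ ((1 : ℂ) / 2)))) *
    Complex.exp (Complex.I * ((p₁ * x ^ 2 + p₂ * x * y + p₃ * y ^ 2 : ℝ) : ℂ) / (2 * (T : ℂ))) *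
    Complex.exp (Complex.I * ((m₁ * u * x + m₂ * v * x + m₃ * u * y + m₄ * v * y : ℝ) : ℂ) / (T : ℂ)) *
    Complex.exp (Complex.I * ((k₁ * u ^ 2 + k₂ * u * v + k₃ * v ^ 2 : ℝ) : ℂ) / (2 * (T : ℂ)))

/-- The 2D nonseparable fractional Fourier transform of `f`. -/
noncomputable def nsfrft (a b c d θ : ℝ) (f : ℝ × ℝ → ℂ) (u v : ℝ) : ℂ :=
  ∫ p : ℝ × ℝ, f p * nsKernel a b c d θ p.1 p.2 u v

open scoped FourierTransform

lemma hasTemperateGrowth_cexp_I_mul :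
    Function.HasTemperateGrowth (fun t : ℝ => cexp (I * t)) := by
  have key : ∀ n : ℕ, iteratedDeriv n (fun t : ℝ => cexp (I * t)) =
      fun t : ℝ => I ^ n * cexp (I * t) := by
    intro n
    induction n with
    | zero => simp
    | succ n ih =>
      rw [iteratedDeriv_succ, ih]
      ext t
      have h : HasDerivAt (fun t : ℝ => I * (t : ℂ)) (I * 1) t :=
        (Complex.ofRealCLM.hasDerivAt (x := t)).const_mul I
      rw [(h.cexp.const_mul (I ^ n)).deriv]
      ring
  refine ⟨(contDiff_const.mul Complex.ofRealCLM.contDiff).cexp, fun n => ⟨0, 1, fun t => ?_⟩⟩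
  rw [norm_iteratedFDeriv_eq_norm_iteratedDeriv, key]
  simp [mul_comm I, Complex.norm_exp_ofReal_mul_I]

/-- Fourier inversion for Schwartz functions on `ℝ × ℝ`, in coordinates. -/
lemma SchwartzMap.integral_prod_fourier_inversion (g : SchwartzMap (ℝ × ℝ) ℂ) (x y : ℝ) :
    ∫ w : ℝ × ℝ, (∫ p : ℝ × ℝ, g p * cexp (-(2 * π * (p.1 * w.1 + p.2 * w.2) : ℝ) * I)) *
      cexp ((2 * π * (x * w.1 + y * w.2) : ℝ) * I) = g (x, y) := by
  let G : SchwartzMap ℂ ℂ := SchwartzMap.compCLMOfContinuousLinearEquiv ℂ equivRealProdCLM g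
  have hG : ∀ z : ℂ, G z = g (z.re, z.im) := fun z => rfl
  have inv : 𝓕⁻ (𝓕 (G : ℂ → ℂ)) = G := G.continuous.fourierInv_fourier_eq G.integrable
    (SchwartzMap.fourier_coe G ▸ (𝓕 G).integrable)
  have e := congrFun inv ⟨x, y⟩
  have hmp := Complex.volume_preserving_equiv_real_prod
  have hme := Complex.measurableEquivRealProd.measurableEmbedding
  rw [Real.fourierInv_eq', hG] at e
  rw [← e, ← hmp.integral_comp hme]
  refine integral_congr_ae (.of_forall fun w => ?_)
  simp only [Real.fourier_eq', smul_eq_mul]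
  rw [← hmp.integral_comp hme, mul_comm]
  congr 1
  · congr 3
    simp [Complex.inner]
  · refine integral_congr_ae (.of_forall fun z => ?_)
    simp only [hG]
    rw [mul_comm]
    congr 2
    simp [Complex.inner]
    ring

/-- Linear change of variables in the plane. -/
lemma integral_comp_linear_prod {A B C D : ℝ} (hdet : A * D - B * C ≠ 0) (H : ℝ × ℝ → ℂ) :
    ∫ q : ℝ × ℝ, H (A * q.1 + B * q.2, C * q.1 + D * q.2) =
      ((|A * D - B * C|⁻¹ : ℝ) : ℂ) * ∫ q, H q := by
  let M := Matrix.toLin (Module.Basis.finTwoProd ℝ) (Module.Basis.finTwoProd ℝ) !![A, B; C, D]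
  have hM : ∀ q, M q = (A * q.1 + B * q.2, C * q.1 + D * q.2) := fun q => by
    simp [M, Matrix.toLin_finTwoProd]
  have hd : LinearMap.det M = A * D - B * C := by
    simp [M, LinearMap.det_toLin, Matrix.det_fin_two_of]
  have hd0 : LinearMap.det M ≠ 0 := by rwa [hd]
  let e := (LinearEquiv.ofIsUnitDet (f := M) (v := Module.Basis.finTwoProd ℝ)
    (v' := Module.Basis.finTwoProd ℝ)
    (by simpa [M, Matrix.det_fin_two_of] using hdet)).toContinuousLinearEquiv
  have hmap := Measure.map_linearMap_addHaar_eq_smul_addHaar (volume : Measure (ℝ × ℝ)) hd0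
  have h1 := e.toHomeomorph.measurableEmbedding.integral_map (μ := volume) H
  have h2 : (⇑e.toHomeomorph : ℝ × ℝ → ℝ × ℝ) = M := rfl
  rw [h2, hmap, integral_smul_measure, hd] at h1
  simp only [hM] at h1
  rw [← h1, ENNReal.toReal_ofReal (abs_nonneg _), abs_inv]
  simp

lemma normSq_neg_cpow_half (T : ℝ) :
    (-(T : ℂ)) ^ ((1 : ℂ) / 2) * (starRingEnd ℂ) ((-(T : ℂ)) ^ ((1 : ℂ) / 2)) = ((|T| : ℝ) : ℂ) := by
  rw [Complex.mul_conj, Complex.normSq_eq_norm_sq, ← norm_pow, ← Complex.cpow_nat_mul]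
  norm_num

/-- The kernel is a constant times unimodular exponentials: chirps in `(x, y)` and in `(u, v)`,
and a Fourier character whose frequency depends linearly on `(u, v)`. -/
lemma exists_nsKernel_eq {a b c d θ : ℝ} (hT : nsT a b c d θ ≠ 0) :
    ∃ A B C D q₁ q₂ q₃ : ℝ, ∃ R : ℝ → ℝ → ℝ,
      A * D - B * C = (4 * π ^ 2 * nsT a b c d θ)⁻¹ ∧
      ∀ x y u v, nsKernel a b c d θ x y u v =
        (2 * (π : ℂ) * (-(nsT a b c d θ : ℂ)) ^ ((1 : ℂ) / 2))⁻¹ *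
        cexp (I * (q₁ * x ^ 2 + q₂ * x * y + q₃ * y ^ 2 : ℝ)) *
        cexp (-(2 * π * (x * (A * u + B * v) + y * (C * u + D * v)) : ℝ) * I) *
        cexp (I * (R u v : ℝ)) := by
  have hπ := Real.pi_ne_zero
  have hTc : (nsT a b c d θ : ℂ) ≠ 0 := by exact_mod_cast hT
  have hπc : (π : ℂ) ≠ 0 := by exact_mod_cast hπ
  refine ⟨-(-a * Real.sin θ + c * Real.cos θ) / (2 * π * nsT a b c d θ),
    -(b * Real.sin θ + d * Real.cos θ) / (2 * π * nsT a b c d θ),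
    -(-b * Real.sin θ + d * Real.cos θ) / (2 * π * nsT a b c d θ),
    -(-a * Real.sin θ - c * Real.cos θ) / (2 * π * nsT a b c d θ),
    (Real.sin θ * Real.cos θ - a * c + b * d) / (2 * nsT a b c d θ),
    (-2 * (b * c + a * d)) / (2 * nsT a b c d θ),
    (Real.sin θ * Real.cos θ + a * c - b * d) / (2 * nsT a b c d θ),
    fun u v => ((Real.sin θ * Real.cos θ - a * c - b * d) * u ^ 2 +
      2 * (b * c - a * d) * u * v + (Real.sin θ * Real.cos θ + a * c + b * d) * v ^ 2) /
      (2 * nsT a b c d θ), ?_, fun x y u v => ?_⟩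
  · field_simp
    rw [nsT]
    ring
  · rw [nsKernel]
    simp only [one_div]
    congr 2
    · congr 2
      push_cast
      field_simp
    · push_cast
      field_simp
      ring_nf
    · push_cast
      field_simp

theorem nsfrft_inversion (a b c d θ : ℝ)
    (h : a ^ 2 + b ^ 2 + c ^ 2 + d ^ 2 = 1)
    (hT : nsT a b c d θ ≠ 0)
    (f : SchwartzMap (ℝ × ℝ) ℂ) :
    ∀ x y : ℝ,
      (∫ q : ℝ × ℝ,
          nsfrft a b c d θ (fun p => f p) q.1 q.2 *
            (starRingEnd ℂ) (nsKernel a b c d θ x y q.1 q.2)) = f (x, y) := by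
  intro x y
  obtain ⟨A, B, C, D, q₁, q₂, q₃, R, hdet, hK⟩ := exists_nsKernel_eq hT
  have hdet0 : A * D - B * C ≠ 0 := by
    rw [hdet]
    have := Real.pi_ne_zero
    positivity
  have hchirp : Function.HasTemperateGrowth fun p : ℝ × ℝ =>
      cexp (I * (q₁ * p.1 ^ 2 + q₂ * p.1 * p.2 + q₃ * p.2 ^ 2 : ℝ)) := by
    have h1 : Function.HasTemperateGrowth fun p : ℝ × ℝ => p.1 :=
      (ContinuousLinearMap.fst ℝ ℝ ℝ).hasTemperateGrowth
    have h2 : Function.HasTemperateGrowth fun p : ℝ × ℝ => p.2 :=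
      (ContinuousLinearMap.snd ℝ ℝ ℝ).hasTemperateGrowth
    exact hasTemperateGrowth_cexp_I_mul.comp
      (f := fun p : ℝ × ℝ => q₁ * p.1 ^ 2 + q₂ * p.1 * p.2 + q₃ * p.2 ^ 2) (by fun_prop)
  let g : SchwartzMap (ℝ × ℝ) ℂ := SchwartzMap.smulLeftCLM ℂ (fun p : ℝ × ℝ =>
      cexp (I * (q₁ * p.1 ^ 2 + q₂ * p.1 * p.2 + q₃ * p.2 ^ 2 : ℝ))) f
  have hg : ∀ p, g p = cexp (I * (q₁ * p.1 ^ 2 + q₂ * p.1 * p.2 + q₃ * p.2 ^ 2 : ℝ)) * f p :=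
    fun p => SchwartzMap.smulLeftCLM_apply_apply hchirp f p
  have hconj : ∀ r : ℝ, (starRingEnd ℂ) (cexp (I * r)) = cexp (-(I * r)) := fun r => by
    rw [← Complex.exp_conj]
    simp
  have hconj' : ∀ r : ℝ, (starRingEnd ℂ) (cexp (-r * I)) = cexp (r * I) := fun r => by
    rw [← Complex.exp_conj]
    simp
  set N : ℂ := (2 * (π : ℂ) * (-(nsT a b c d θ : ℂ)) ^ ((1 : ℂ) / 2))⁻¹ with hN
  have hNN : N * (starRingEnd ℂ) N = (|A * D - B * C| : ℝ) := by
    rw [hN, map_inv₀, ← mul_inv, hdet, map_mul, mul_mul_mul_comm, normSq_neg_cpow_half, abs_inv,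
      abs_mul, abs_of_pos (by positivity : 0 < 4 * π ^ 2)]
    simp only [map_mul, map_ofNat, Complex.conj_ofReal]
    push_cast
    ring
  let H : ℝ × ℝ → ℂ := fun w =>
    (∫ p : ℝ × ℝ, g p * cexp (-(2 * π * (p.1 * w.1 + p.2 * w.2) : ℝ) * I)) *
      cexp ((2 * π * (x * w.1 + y * w.2) : ℝ) * I)
  have hF : ∀ u v, nsfrft a b c d θ (fun p => f p) u v = N * cexp (I * (R u v : ℝ)) *
      ∫ p : ℝ × ℝ, g p *
        cexp (-(2 * π * (p.1 * (A * u + B * v) + p.2 * (C * u + D * v)) : ℝ) * I) := fun u v => by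
    rw [nsfrft, ← integral_const_mul]
    refine integral_congr_ae (.of_forall fun p => ?_)
    simp only [hK, hg]
    ring
  set E : ℂ := cexp (I * (q₁ * x ^ 2 + q₂ * x * y + q₃ * y ^ 2 : ℝ)) with hE
  have hEE : (starRingEnd ℂ) E * E = 1 := by
    rw [hE, hconj, ← Complex.exp_add, neg_add_cancel, Complex.exp_zero]
  have hint : ∀ q : ℝ × ℝ, nsfrft a b c d θ (fun p => f p) q.1 q.2 *
      (starRingEnd ℂ) (nsKernel a b c d θ x y q.1 q.2) =
      N * (starRingEnd ℂ) N * (starRingEnd ℂ) E *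
        H (A * q.1 + B * q.2, C * q.1 + D * q.2) := fun q => by
    have hR : cexp (I * (R q.1 q.2 : ℝ)) * cexp (-(I * (R q.1 q.2 : ℝ))) = 1 := by
      rw [← Complex.exp_add, add_neg_cancel, Complex.exp_zero]
    rw [hF, hK]
    simp only [map_mul, hconj', hconj (R q.1 q.2), H]
    linear_combination (N * (starRingEnd ℂ) N * (starRingEnd ℂ) E *
      H (A * q.1 + B * q.2, C * q.1 + D * q.2)) * hR
  simp only [hint]
  rw [integral_const_mul, integral_comp_linear_prod hdet0,
    SchwartzMap.integral_prod_fourier_inversion g x y, hg, hNN]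
  have hd : ((|A * D - B * C|⁻¹ : ℝ) : ℂ) * (|A * D - B * C| : ℝ) = 1 := by
    exact_mod_cast inv_mul_cancel₀ (abs_ne_zero.mpr hdet0)
  rw [← hE]
  linear_combination f (x, y) * (starRingEnd ℂ) E * E * hd + f (x, y) * hEE
end

section
/- Energy conservation (Parseval identity) for the 2D nonseparable fractional Fourier transform: let a, b, c, d, θ be real numbers with a² + b² + c² + d² = 1 and T ≠ 0, and let f : ℝ² → ℂ be a Schwartz function. Then ∫_{ℝ²} |f(x,y)|² dx dy = ∫_{ℝ²} |F_P(u,v)|² du dv, where F_P(u,v) = ∫_{ℝ²} f(x,y) K_P(x,y,u,v) dx dy. -/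
open Real Complex MeasureTheory

open scoped FourierTransform

theorem iteratedDeriv_cexp_I_mul_ofReal (n : ℕ) :
    iteratedDeriv n (fun t : ℝ => Complex.exp (Complex.I * (t : ℂ))) =
      fun t : ℝ => Complex.I ^ n * Complex.exp (Complex.I * (t : ℂ)) := by
  induction n with
  | zero => simp
  | succ n ih =>
    rw [iteratedDeriv_succ, ih]
    funext t
    have h : HasDerivAt (fun s : ℝ => Complex.I * (s : ℂ)) (Complex.I * 1) t :=
      (HasDerivAt.ofReal_comp (hasDerivAt_id t)).const_mul Complex.I
    rw [(h.cexp.const_mul (Complex.I ^ n)).deriv]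
    ring

theorem hasTemperateGrowth_cexp_I_mul_ofReal :
    Function.HasTemperateGrowth (fun t : ℝ => Complex.exp (Complex.I * (t : ℂ))) := by
  refine ⟨(contDiff_const.mul Complex.ofRealCLM.contDiff).cexp, fun n => ⟨0, 1, fun t => ?_⟩⟩
  rw [norm_iteratedFDeriv_eq_norm_iteratedDeriv, iteratedDeriv_cexp_I_mul_ofReal]
  simp [Complex.norm_exp]

theorem integral_comp_linearMap {E F : Type*} [NormedAddCommGroup E] [NormedSpace ℝ E]
    [MeasurableSpace E] [BorelSpace E] [FiniteDimensional ℝ E] [NormedAddCommGroup F]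
    [NormedSpace ℝ F] (μ : Measure E) [μ.IsAddHaarMeasure] {L : E →ₗ[ℝ] E}
    (hL : LinearMap.det L ≠ 0) {G : E → F} (hG : AEStronglyMeasurable G μ) :
    ∫ x, G (L x) ∂μ = |(LinearMap.det L)⁻¹| • ∫ x, G x ∂μ := by
  have hmap := Measure.map_linearMap_addHaar_eq_smul_addHaar μ hL
  rw [← integral_map (φ := L) L.continuous_of_finiteDimensional.aemeasurable
    (by rw [hmap]; exact hG.smul_measure _), hmap, integral_smul_measure,
    ENNReal.toReal_ofReal (abs_nonneg _)]

/-- Parseval's identity for a chirp-multiplied Schwartz function on the plane, followed by the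
Fourier transform in arbitrary linear coordinates. -/
theorem integral_norm_sq_chirp_fourier (f : SchwartzMap (ℝ × ℝ) ℂ) (φ : ℝ × ℝ → ℝ)
    (hφ : φ.HasTemperateGrowth) (m₁ m₂ m₃ m₄ : ℝ) (hm : m₁ * m₄ - m₂ * m₃ ≠ 0) :
    ∫ q : ℝ × ℝ, ‖∫ p : ℝ × ℝ, f p * (Complex.exp (Complex.I * (φ p : ℂ)) *
        Complex.exp (Complex.I *
          ((m₁ * q.1 * p.1 + m₂ * q.2 * p.1 + m₃ * q.1 * p.2 + m₄ * q.2 * p.2 : ℝ) : ℂ)))‖ ^ 2 =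
      (2 * π) ^ 2 / |m₁ * m₄ - m₂ * m₃| * ∫ p : ℝ × ℝ, ‖f p‖ ^ 2 := by
  let e := WithLp.prodContinuousLinearEquiv 2 ℝ ℝ ℝ
  have he : MeasurePreserving (WithLp.ofLp : WithLp 2 (ℝ × ℝ) → ℝ × ℝ) :=
    WithLp.volume_preserving_ofLp ℝ ℝ
  have hemb : MeasurableEmbedding (WithLp.ofLp : WithLp 2 (ℝ × ℝ) → ℝ × ℝ) :=
    e.toHomeomorph.measurableEmbedding
  let χ : ℝ × ℝ → ℂ := fun p => Complex.exp (Complex.I * (φ p : ℂ))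
  have hχ : χ.HasTemperateGrowth := hasTemperateGrowth_cexp_I_mul_ofReal.comp hφ
  let g : SchwartzMap (WithLp 2 (ℝ × ℝ)) ℂ :=
    SchwartzMap.compCLMOfContinuousLinearEquiv ℂ e (SchwartzMap.smulLeftCLM ℂ χ f)
  have hg : ∀ p, g p = χ p.ofLp * f p.ofLp := fun p => by
    change SchwartzMap.smulLeftCLM ℂ χ f (e p) = _
    rw [SchwartzMap.smulLeftCLM_apply_apply hχ]
    rfl
  let s : ℝ := -(2 * π)⁻¹
  let L : ℝ × ℝ →ₗ[ℝ] ℝ × ℝ := Matrix.toLin (Module.Basis.finTwoProd ℝ)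
    (Module.Basis.finTwoProd ℝ) !![s * m₁, s * m₂; s * m₃, s * m₄]
  have hL : ∀ q, L q = (s * m₁ * q.1 + s * m₂ * q.2, s * m₃ * q.1 + s * m₄ * q.2) := fun q =>
    Matrix.toLin_finTwoProd_apply ..
  have hdet : LinearMap.det L = s ^ 2 * (m₁ * m₄ - m₂ * m₃) := by
    rw [LinearMap.det_toLin, Matrix.det_fin_two_of]
    ring
  have hs : s ≠ 0 := by simp [s, Real.pi_ne_zero]
  have hdet0 : LinearMap.det L ≠ 0 := by
    rw [hdet]
    exact mul_ne_zero (pow_ne_zero _ hs) hm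
  let G : ℝ × ℝ → ℝ := fun w => ‖𝓕 g (WithLp.toLp 2 w)‖ ^ 2
  have hG : Continuous G := (((𝓕 g).continuous.comp e.symm.continuous).norm).pow 2
  have key : ∀ q : ℝ × ℝ, ‖∫ p : ℝ × ℝ, f p * (Complex.exp (Complex.I * (φ p : ℂ)) *
        Complex.exp (Complex.I *
          ((m₁ * q.1 * p.1 + m₂ * q.2 * p.1 + m₃ * q.1 * p.2 + m₄ * q.2 * p.2 : ℝ) : ℂ)))‖ ^ 2 =
      G (L q) := fun q => by
    simp only [G]
    rw [SchwartzMap.fourier_coe, Real.fourier_eq', ← he.integral_comp hemb]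
    congr 2
    refine integral_congr_ae (Filter.Eventually.of_forall fun p => ?_)
    have harg : -2 * π * inner ℝ p (WithLp.toLp 2 (L q)) =
        m₁ * q.1 * p.ofLp.1 + m₂ * q.2 * p.ofLp.1 + m₃ * q.1 * p.ofLp.2
          + m₄ * q.2 * p.ofLp.2 := by
      rw [WithLp.prod_inner_apply, hL]
      simp only [s, RCLike.inner_apply, conj_trivial]
      field_simp
      ring
    simp only [hg, harg, χ, smul_eq_mul]
    rw [mul_comm Complex.I]
    ring_nf
  simp_rw [key]
  rw [integral_comp_linearMap volume hdet0 hG.aestronglyMeasurable, ← he.integral_comp hemb G]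
  have hP : ∫ x : WithLp 2 (ℝ × ℝ), G x.ofLp = ∫ p : ℝ × ℝ, ‖f p‖ ^ 2 := by
    change ∫ x : WithLp 2 (ℝ × ℝ), ‖𝓕 g x‖ ^ 2 = _
    rw [SchwartzMap.integral_norm_sq_fourier, ← he.integral_comp hemb]
    refine integral_congr_ae (Filter.Eventually.of_forall fun p => ?_)
    simp [hg, χ, Complex.norm_exp]
  rw [hP, hdet, smul_eq_mul, abs_inv, abs_mul, abs_of_pos (by positivity : 0 < s ^ 2)]
  congr 1
  simp only [s]
  field_simp

theorem norm_sq_cpow_half (z : ℂ) : ‖z ^ ((1 : ℂ) / 2)‖ ^ 2 = ‖z‖ := by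
  rw [← norm_pow, one_div, ← Nat.cast_ofNat, Complex.cpow_nat_inv_pow z two_ne_zero]

theorem norm_cexp_I_mul_ofReal_div (x t : ℝ) :
    ‖Complex.exp (Complex.I * (x : ℂ) / (2 * (t : ℂ)))‖ = 1 := by
  have : Complex.I * (x : ℂ) / (2 * (t : ℂ)) = ((x / (2 * t) : ℝ) : ℂ) * Complex.I := by
    push_cast
    ring
  rw [this, Complex.norm_exp_ofReal_mul_I]

theorem nsfrft_energy_conservation (a b c d θ : ℝ)
    (h : a ^ 2 + b ^ 2 + c ^ 2 + d ^ 2 = 1)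
    (hT : nsT a b c d θ ≠ 0)
    (f : SchwartzMap (ℝ × ℝ) ℂ) :
    ∫ p : ℝ × ℝ, ‖f p‖ ^ 2 =
      ∫ q : ℝ × ℝ, ‖nsfrft a b c d θ (fun p => f p) q.1 q.2‖ ^ 2 := by
  obtain ⟨T, hTdef⟩ : ∃ T, T = nsT a b c d θ := ⟨_, rfl⟩
  rw [← hTdef] at hT
  let φ : ℝ × ℝ → ℝ := fun p =>
    (2 * T)⁻¹ * ((Real.sin θ * Real.cos θ - a * c + b * d) * p.1 ^ 2
      + -2 * (b * c + a * d) * p.1 * p.2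
      + (Real.sin θ * Real.cos θ + a * c - b * d) * p.2 ^ 2)
  have hφ : φ.HasTemperateGrowth := by
    have h1 : Function.HasTemperateGrowth (fun p : ℝ × ℝ => p.1) :=
      (ContinuousLinearMap.fst ℝ ℝ ℝ).hasTemperateGrowth
    have h2 : Function.HasTemperateGrowth (fun p : ℝ × ℝ => p.2) :=
      (ContinuousLinearMap.snd ℝ ℝ ℝ).hasTemperateGrowth
    simp only [φ]
    fun_prop
  let m₁ : ℝ := (-a * Real.sin θ + c * Real.cos θ) / T
  let m₂ : ℝ := (b * Real.sin θ + d * Real.cos θ) / T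
  let m₃ : ℝ := (-b * Real.sin θ + d * Real.cos θ) / T
  let m₄ : ℝ := (-a * Real.sin θ - c * Real.cos θ) / T
  have hm : m₁ * m₄ - m₂ * m₃ = T⁻¹ := by
    have : m₁ * m₄ - m₂ * m₃ = nsT a b c d θ / T ^ 2 := by
      simp only [m₁, m₂, m₃, m₄, nsT]
      ring
    rw [this, ← hTdef]
    field_simp
  let A : ℂ := 1 / (2 * (Real.pi : ℂ) * ((-(T : ℂ)) ^ ((1 : ℂ) / 2)))
  have hA : ‖A‖ ^ 2 = 1 / ((2 * π) ^ 2 * |T|) := by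
    simp only [A, norm_div, norm_mul, norm_one, div_pow, mul_pow, norm_sq_cpow_half, norm_neg,
      Complex.norm_real, Real.norm_eq_abs, sq_abs, one_pow, RCLike.norm_ofNat]
  have hF : ∀ q : ℝ × ℝ, ‖nsfrft a b c d θ (fun p => f p) q.1 q.2‖ ^ 2 =
      ‖A‖ ^ 2 * ‖∫ p : ℝ × ℝ, f p * (Complex.exp (Complex.I * (φ p : ℂ)) *
        Complex.exp (Complex.I *
          ((m₁ * q.1 * p.1 + m₂ * q.2 * p.1 + m₃ * q.1 * p.2 + m₄ * q.2 * p.2 : ℝ) : ℂ)))‖ ^ 2 := by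
    intro q
    let B : ℂ := Complex.exp (Complex.I * (((Real.sin θ * Real.cos θ - a * c - b * d) * q.1 ^ 2
      + 2 * (b * c - a * d) * q.1 * q.2
      + (Real.sin θ * Real.cos θ + a * c + b * d) * q.2 ^ 2 : ℝ) : ℂ) / (2 * (T : ℂ)))
    have hB : ‖B‖ = 1 := norm_cexp_I_mul_ofReal_div _ _
    have : nsfrft a b c d θ (fun p => f p) q.1 q.2 = (A * B) *
        ∫ p : ℝ × ℝ, f p * (Complex.exp (Complex.I * (φ p : ℂ)) *
        Complex.exp (Complex.I *
          ((m₁ * q.1 * p.1 + m₂ * q.2 * p.1 + m₃ * q.1 * p.2 + m₄ * q.2 * p.2 : ℝ) : ℂ))) := by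
      rw [nsfrft, ← integral_const_mul]
      refine integral_congr_ae (Filter.Eventually.of_forall fun p => ?_)
      simp only [nsKernel, ← hTdef]
      have e1 : Complex.I * (((Real.sin θ * Real.cos θ - a * c + b * d) * p.1 ^ 2
          + -2 * (b * c + a * d) * p.1 * p.2
          + (Real.sin θ * Real.cos θ + a * c - b * d) * p.2 ^ 2 : ℝ) : ℂ) / (2 * (T : ℂ)) =
          Complex.I * (φ p : ℂ) := by
        simp only [φ, Complex.ofReal_mul (2 * T)⁻¹]
        push_cast
        ring
      have e2 : Complex.I * (((-a * Real.sin θ + c * Real.cos θ) * q.1 * p.1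
          + (b * Real.sin θ + d * Real.cos θ) * q.2 * p.1
          + (-b * Real.sin θ + d * Real.cos θ) * q.1 * p.2
          + (-a * Real.sin θ - c * Real.cos θ) * q.2 * p.2 : ℝ) : ℂ) / (T : ℂ) =
          Complex.I * ((m₁ * q.1 * p.1 + m₂ * q.2 * p.1 + m₃ * q.1 * p.2
            + m₄ * q.2 * p.2 : ℝ) : ℂ) := by
        rw [mul_div_assoc, ← Complex.ofReal_div]
        congr 2
        simp only [m₁, m₂, m₃, m₄]
        ring
      rw [e1, e2]
      simp only [A, B]
      ring
    rw [this, norm_mul, norm_mul, hB, mul_one, mul_pow]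
  simp_rw [hF]
  rw [integral_const_mul, integral_norm_sq_chirp_fourier f φ hφ m₁ m₂ m₃ m₄
    (by rw [hm]; exact inv_ne_zero hT), hm, hA, abs_inv]
  have : |T| ≠ 0 := abs_ne_zero.mpr hT
  field_simp
end

section
/- Rotation relationship between the 2D nonseparable fractional Fourier transform and the 2D Wigner distribution: let a, b, c, d, θ be real numbers with a² + b² + c² + d² = 1 and T ≠ 0, and let f : ℝ² → ℂ be a Schwartz function with 2D NSFRFT F_P. Write l_θ(m,n) = m cos θ − n sin θ. Then for all (x, y, u, v) ∈ ℝ⁴, W_{F_P}(x, y, u, v) = W_f(x̃, ỹ, ũ, ṽ), where x̃ = l_θ(a,c)x + l_θ(−b,d)y + l_θ(−c,a)u + l_θ(−d,−b)v, ỹ = l_θ(b,d)x + l_θ(a,−c)y + l_θ(−d,b)u + l_θ(c,a)v, ũ = l_θ(c,−a)x + l_θ(d,b)y + l_θ(a,c)u + l_θ(−b,d)v, ṽ = l_θ(d,−b)x + l_θ(−c,−a)y + l_θ(b,d)u + l_θ(a,−c)v. -/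
open Real Complex MeasureTheory

/-- The 2D Wigner distribution of a function g : ℝ² → ℂ. -/
noncomputable def wigner2D (g : ℝ × ℝ → ℂ) (x y u v : ℝ) : ℂ :=
  ∫ p : ℝ × ℝ,
    g (x + p.1 / 2, y + p.2 / 2) * (starRingEnd ℂ) (g (x - p.1 / 2, y - p.2 / 2)) *
      Complex.exp (-(Complex.I) * ((u * p.1 + v * p.2 : ℝ) : ℂ))

open scoped FourierTransform ComplexConjugate RealInnerProductSpace SchwartzMap

theorem hasTemperateGrowth_cexp_ofReal_mul_I :
    Function.HasTemperateGrowth (fun t : ℝ => cexp (t * I)) := by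
  refine ⟨(Complex.ofRealCLM.contDiff.mul contDiff_const).cexp, fun n => ⟨0, 1, fun x => ?_⟩⟩
  have key : ∀ n : ℕ, iteratedDeriv n (fun t : ℝ => cexp (t * I)) =
      fun t : ℝ => I ^ n * cexp (t * I) := by
    intro n
    induction n with
    | zero => simp
    | succ n ih =>
      rw [iteratedDeriv_succ, ih]
      ext t
      have h : HasDerivAt (fun t : ℝ => cexp (t * I)) (cexp (t * I) * (1 * I)) t :=
        ((hasDerivAt_id t).ofReal_comp.mul_const I).cexp
      rw [(h.const_mul (I ^ n)).deriv]
      ring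
  rw [norm_iteratedFDeriv_eq_norm_iteratedDeriv, key]
  simp [norm_exp_ofReal_mul_I]

section
variable {V : Type*} [NormedAddCommGroup V] [InnerProductSpace ℝ V] [FiniteDimensional ℝ V]
  [MeasurableSpace V] [BorelSpace V]

theorem fourier_modulate_translate (ψ : V → ℂ) (ξ η ρ : V) :
    𝓕 (fun s => ψ (s - η) * 𝐞 (-⟪ξ, s - η⟫)) ρ = 𝓕 ψ (ξ + ρ) * 𝐞 (-⟪η, ρ⟫) := by
  rw [Real.fourier_eq, Real.fourier_eq, ← integral_add_right_eq_self _ η, ← integral_mul_const]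
  congr 1 with s
  simp only [add_sub_cancel_right, Circle.smul_def, smul_eq_mul]
  have : (𝐞 (-⟪s + η, ρ⟫) : ℂ) * 𝐞 (-⟪ξ, s⟫) = 𝐞 (-⟪s, ξ + ρ⟫) * 𝐞 (-⟪η, ρ⟫) := by
    rw [← Circle.coe_mul, ← Circle.coe_mul, ← AddChar.map_add_eq_mul, ← AddChar.map_add_eq_mul]
    congr 2
    rw [inner_add_left, inner_add_right, real_inner_comm ξ s]
    ring
  linear_combination ψ s * this

theorem fourier_conj_fourier_sub (ψ : 𝓢(V, ℂ)) (ξ s : V) :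
    𝓕 (fun ρ => conj (𝓕 ψ (ξ - ρ))) s = 𝐞 (-⟪ξ, s⟫) * conj (ψ (-s)) := by
  have hinv : ψ (-s) = ∫ ρ, 𝐞 (⟪ρ, -s⟫) • 𝓕 ψ ρ := by
    rw [← Real.fourierInv_eq]
    rw [← SchwartzMap.fourierInv_coe, FourierTransform.fourierInv_fourier_eq]
  rw [hinv, ← integral_conj, Real.fourier_eq, ← integral_sub_left_eq_self _ _ ξ,
    ← integral_const_mul]
  congr 1 with ρ
  simp only [sub_sub_cancel, Circle.smul_def, smul_eq_mul, map_mul, ← mul_assoc]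
  congr 1
  rw [← Circle.coe_inv_eq_conj, ← AddChar.map_neg_eq_inv, ← Circle.coe_mul,
    ← AddChar.map_add_eq_mul]
  congr 2
  rw [inner_sub_left, inner_neg_right]
  ring

/-- The Fourier transform rotates the Wigner distribution by a quarter turn. -/
theorem integral_fourier_ambiguity (ψ : 𝓢(V, ℂ)) (ξ η : V) :
    ∫ ρ, 𝓕 ψ (ξ + ρ) * conj (𝓕 ψ (ξ - ρ)) * 𝐞 (-(2 * ⟪η, ρ⟫)) =
      ∫ s, ψ (-η + s) * conj (ψ (-η - s)) * 𝐞 (-(2 * ⟪ξ, s⟫)) := by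
  set h : V → ℂ := fun s => ψ (s - (2 : ℝ) • η) * 𝐞 (-⟪ξ, s - (2 : ℝ) • η⟫) with hh
  have hint : Integrable h := by
    have h1 : Integrable (fun s => ψ (s - (2 : ℝ) • η)) := ψ.integrable.comp_sub_right _
    refine h1.mul_bdd (c := 1) ?_ (.of_forall fun s => (Circle.norm_coe _).le)
    have hc : Continuous fun s : V => (-⟪ξ, s - (2 : ℝ) • η⟫) := by fun_prop
    exact (continuous_subtype_val.comp (Real.continuous_fourierChar.comp hc)).aestronglyMeasurable
  have kint : Integrable (fun ρ => conj (𝓕 ψ (ξ - ρ))) := by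
    have h1 : Integrable (fun ρ => 𝓕 ψ (ξ - ρ)) := (𝓕 ψ).integrable.comp_sub_left ξ
    exact (LinearIsometryEquiv.integrable_comp_iff Complex.conjLIE).2 h1
  have main := VectorFourier.integral_fourierIntegral_smul_eq_flip (L := innerₗ V)
    (μ := volume) (ν := volume) Real.continuous_fourierChar continuous_inner hint kint
  have main' : ∫ ρ, 𝓕 h ρ * conj (𝓕 ψ (ξ - ρ)) =
      ∫ s, h s * 𝓕 (fun ρ => conj (𝓕 ψ (ξ - ρ))) s := by
    simpa using! main
  have e1 : ∀ ρ, 𝓕 ψ (ξ + ρ) * conj (𝓕 ψ (ξ - ρ)) * 𝐞 (-(2 * ⟪η, ρ⟫)) =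
      𝓕 h ρ * conj (𝓕 ψ (ξ - ρ)) := by
    intro ρ
    rw [hh, fourier_modulate_translate, real_inner_smul_left, SchwartzMap.fourier_coe]
    ring
  simp_rw [e1]
  rw [main', ← integral_add_right_eq_self _ η]
  congr 1 with s
  rw [fourier_conj_fourier_sub]
  simp only [hh]
  have : (𝐞 (-⟪ξ, -η + s⟫) : ℂ) * 𝐞 (-⟪ξ, s + η⟫) = 𝐞 (-(2 * ⟪ξ, s⟫)) := by
    rw [← Circle.coe_mul, ← AddChar.map_add_eq_mul]
    congr 2
    rw [inner_add_right, inner_add_right, inner_neg_right]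
    ring
  rw [← this, show s + η - (2 : ℝ) • η = -η + s by module, show -(s + η) = -η - s by abel]
  ring

end

theorem inner_toLp_prod (p q : ℝ × ℝ) :
    ⟪WithLp.toLp 2 p, WithLp.toLp 2 q⟫ = p.1 * q.1 + p.2 * q.2 := by
  simp [WithLp.prod_inner_apply, mul_comm]

theorem fourier_comp_ofLp_eq (Φ : ℝ × ℝ → ℂ) (p : ℝ × ℝ) :
    𝓕 (fun z : WithLp 2 (ℝ × ℝ) => Φ z.ofLp) (WithLp.toLp 2 ((2 * π)⁻¹ • p)) =
      ∫ q, Φ q * cexp ((-(p.1 * q.1 + p.2 * q.2) : ℝ) * I) := by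
  rw [Real.fourier_eq, ← (WithLp.volume_preserving_toLp ℝ ℝ).integral_comp
    (MeasurableEquiv.toLp 2 (ℝ × ℝ)).measurableEmbedding]
  congr 1 with q
  rw [Circle.smul_def, Real.fourierChar_apply, smul_eq_mul, mul_comm]
  congr 4
  simp only [inner_toLp_prod, Prod.smul_fst, Prod.smul_snd, smul_eq_mul]
  field_simp

theorem integral_fourier_ambiguity_prod (Φ : 𝓢(ℝ × ℝ, ℂ)) (G : ℝ × ℝ → ℂ)
    (hG : ∀ p, G p = ∫ q, Φ q * cexp ((-(p.1 * q.1 + p.2 * q.2) : ℝ) * I)) (ξ η : ℝ × ℝ) :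
    ∫ σ : ℝ × ℝ, G (ξ + (2 : ℝ)⁻¹ • σ) * conj (G (ξ - (2 : ℝ)⁻¹ • σ)) *
        cexp ((-(η.1 * σ.1 + η.2 * σ.2) : ℝ) * I) =
      (4 * π ^ 2 : ℝ) * ∫ t : ℝ × ℝ, Φ (-η + (2 : ℝ)⁻¹ • t) * conj (Φ (-η - (2 : ℝ)⁻¹ • t)) *
        cexp ((-(ξ.1 * t.1 + ξ.2 * t.2) : ℝ) * I) := by
  let ψ : 𝓢(WithLp 2 (ℝ × ℝ), ℂ) := SchwartzMap.compCLMOfContinuousLinearEquiv ℂ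
    (WithLp.prodContinuousLinearEquiv 2 ℝ ℝ ℝ) Φ
  have hψ : ∀ z, ψ z = Φ z.ofLp := fun z => rfl
  have hGψ : ∀ p, G p = 𝓕 ψ (WithLp.toLp 2 ((2 * π)⁻¹ • p)) := fun p => by
    rw [hG, ← fourier_comp_ofLp_eq, SchwartzMap.fourier_coe]
    rfl
  have key := integral_fourier_ambiguity ψ (WithLp.toLp 2 ((2 * π)⁻¹ • ξ)) (WithLp.toLp 2 η)
  rw [← (WithLp.volume_preserving_toLp ℝ ℝ).integral_comp
    (MeasurableEquiv.toLp 2 (ℝ × ℝ)).measurableEmbedding,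
    ← (WithLp.volume_preserving_toLp ℝ ℝ).integral_comp
    (MeasurableEquiv.toLp 2 (ℝ × ℝ)).measurableEmbedding] at key
  have hl := Measure.integral_comp_inv_smul (volume : Measure (ℝ × ℝ)) (fun r =>
    𝓕 ψ (WithLp.toLp 2 ((2 * π)⁻¹ • ξ) + WithLp.toLp 2 r) *
      conj (𝓕 ψ (WithLp.toLp 2 ((2 * π)⁻¹ • ξ) - WithLp.toLp 2 r)) *
      𝐞 (-(2 * ⟪WithLp.toLp 2 η, WithLp.toLp 2 r⟫))) (4 * π)
  have hr := Measure.integral_comp_inv_smul (volume : Measure (ℝ × ℝ)) (fun s =>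
    ψ (-WithLp.toLp 2 η + WithLp.toLp 2 s) *
      conj (ψ (-WithLp.toLp 2 η - WithLp.toLp 2 s)) *
      𝐞 (-(2 * ⟪WithLp.toLp 2 ((2 * π)⁻¹ • ξ), WithLp.toLp 2 s⟫))) 2
  have hdim : Module.finrank ℝ (ℝ × ℝ) = 2 := by simp
  rw [hdim, abs_of_pos (by positivity)] at hl hr
  refine (Eq.trans ?_ hl).trans ?_
  · congr 1 with σ
    rw [hGψ, hGψ, ← WithLp.toLp_add, ← WithLp.toLp_sub, smul_add, smul_sub, smul_smul,
      show (2 * π)⁻¹ * 2⁻¹ = (4 * π)⁻¹ by field_simp; norm_num, Real.fourierChar_apply]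
    congr 4
    simp only [inner_toLp_prod, Prod.smul_fst, Prod.smul_snd, smul_eq_mul]
    field_simp
    ring
  · rw [key]
    refine Eq.trans ?_ (congrArg (fun z => ((4 * π ^ 2 : ℝ) : ℂ) * z) (hr.symm.trans ?_))
    · rw [Complex.real_smul, Complex.real_smul, ← mul_assoc]
      congr 1
      push_cast
      ring
    · congr 1 with t
      rw [← WithLp.toLp_neg, ← WithLp.toLp_add, ← WithLp.toLp_sub, hψ, hψ,
        Real.fourierChar_apply]
      congr 4
      simp only [inner_toLp_prod, Prod.smul_fst, Prod.smul_snd, smul_eq_mul]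
      field_simp

theorem integral_comp_linear_prod_s19 (m₁ m₂ m₃ m₄ : ℝ) (hD : m₁ * m₄ - m₂ * m₃ ≠ 0)
    (F : ℝ × ℝ → ℂ) :
    ∫ τ : ℝ × ℝ, F (m₁ * τ.1 + m₂ * τ.2, m₃ * τ.1 + m₄ * τ.2) =
      (|m₁ * m₄ - m₂ * m₃|⁻¹ : ℝ) * ∫ σ, F σ := by
  let b := Module.Basis.finTwoProd ℝ
  let L : ℝ × ℝ →ₗ[ℝ] ℝ × ℝ := Matrix.toLin b b !![m₁, m₂; m₃, m₄]
  have hL : ∀ τ, L τ = (m₁ * τ.1 + m₂ * τ.2, m₃ * τ.1 + m₄ * τ.2) :=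
    fun τ => Matrix.toLin_finTwoProd_apply _ _ _ _ _
  have hdet : LinearMap.det L = m₁ * m₄ - m₂ * m₃ := by
    rw [LinearMap.det_toLin, Matrix.det_fin_two_of]
  have hdet0 : LinearMap.det L ≠ 0 := hdet ▸ hD
  let e := (LinearEquiv.ofIsUnitDet (v := b) (v' := b) (f := L)
    (by rw [LinearMap.toMatrix_toLin, Matrix.det_fin_two_of]; exact hD.isUnit)).toContinuousLinearEquiv
  have he : MeasurableEmbedding (L : ℝ × ℝ → ℝ × ℝ) :=
    e.toHomeomorph.measurableEmbedding
  have := he.integral_map (μ := volume) F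
  rw [Measure.map_linearMap_addHaar_eq_smul_addHaar _ hdet0, integral_smul_measure,
    ENNReal.toReal_ofReal (abs_nonneg _), hdet, abs_inv, Complex.real_smul] at this
  rw [this]
  simp_rw [hL]

theorem cexp_mul_conj_mul_cexp (r s t : ℝ) :
    cexp (r * I) * conj (cexp (s * I)) * cexp (t * I) = cexp ((r - s + t : ℝ) * I) := by
  rw [← Complex.exp_conj, ← Complex.exp_add, ← Complex.exp_add]
  congr 1
  simp only [map_mul, conj_ofReal, conj_I]
  push_cast
  ring

/-- A transform with a nondegenerate quadratic-phase kernel acts on the Wigner distribution by a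
linear change of variables. -/
theorem wigner2D_quadraticPhase (f : 𝓢(ℝ × ℝ, ℂ)) (C : ℂ)
    (p₁ p₂ p₃ m₁ m₂ m₃ m₄ k₁ k₂ k₃ : ℝ) (hD : m₁ * m₄ - m₂ * m₃ ≠ 0)
    (hC : ‖C‖ ^ 2 * (4 * π ^ 2) = |m₁ * m₄ - m₂ * m₃|) (g : ℝ × ℝ → ℂ)
    (hg : ∀ w : ℝ × ℝ, g w =
      ∫ q : ℝ × ℝ, f q * (C *
        cexp (((p₁ * q.1 ^ 2 + 2 * p₂ * q.1 * q.2 + p₃ * q.2 ^ 2) / 2 : ℝ) * I) *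
        cexp ((m₁ * w.1 * q.1 + m₂ * w.2 * q.1 + m₃ * w.1 * q.2 + m₄ * w.2 * q.2 : ℝ) * I) *
        cexp (((k₁ * w.1 ^ 2 + 2 * k₂ * w.1 * w.2 + k₃ * w.2 ^ 2) / 2 : ℝ) * I)))
    (x y u v X Y U V : ℝ)
    (hu : m₁ * X + m₃ * Y = u - (k₁ * x + k₂ * y))
    (hv : m₂ * X + m₄ * Y = v - (k₂ * x + k₃ * y))
    (hU : U = -(m₁ * x + m₂ * y) - (p₁ * X + p₂ * Y))
    (hV : V = -(m₃ * x + m₄ * y) - (p₂ * X + p₃ * Y)) :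
    wigner2D g x y u v = wigner2D f X Y U V := by
  let P : ℝ × ℝ → ℝ := fun q => (p₁ * q.1 ^ 2 + 2 * p₂ * q.1 * q.2 + p₃ * q.2 ^ 2) / 2
  let K : ℝ × ℝ → ℝ := fun q => (k₁ * q.1 ^ 2 + 2 * k₂ * q.1 * q.2 + k₃ * q.2 ^ 2) / 2
  let L : ℝ × ℝ → ℝ × ℝ := fun τ => (-m₁ * τ.1 + -m₂ * τ.2, -m₃ * τ.1 + -m₄ * τ.2)
  have hP : (fun q => cexp (P q * I)).HasTemperateGrowth := by
    have h1 : (fun q : ℝ × ℝ => q.1).HasTemperateGrowth :=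
      (ContinuousLinearMap.fst ℝ ℝ ℝ).hasTemperateGrowth
    have h2 : (fun q : ℝ × ℝ => q.2).HasTemperateGrowth :=
      (ContinuousLinearMap.snd ℝ ℝ ℝ).hasTemperateGrowth
    refine hasTemperateGrowth_cexp_ofReal_mul_I.comp (f := P) ?_
    simp only [P, div_eq_mul_inv]
    fun_prop
  let Φ : 𝓢(ℝ × ℝ, ℂ) := SchwartzMap.smulLeftCLM ℂ (fun q => cexp (P q * I)) f
  have hΦ : ∀ q, Φ q = cexp (P q * I) * f q := fun q =>
    SchwartzMap.smulLeftCLM_apply_apply hP f q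
  let G : ℝ × ℝ → ℂ := fun p => ∫ q, Φ q * cexp ((-(p.1 * q.1 + p.2 * q.2) : ℝ) * I)
  have hgG : ∀ w, g w = C * cexp (K w * I) * G (L w) := fun w => by
    rw [hg, ← integral_const_mul]
    congr 1 with q
    rw [hΦ, show -((L w).1 * q.1 + (L w).2 * q.2) =
      m₁ * w.1 * q.1 + m₂ * w.2 * q.1 + m₃ * w.1 * q.2 + m₄ * w.2 * q.2 by simp only [L]; ring]
    simp only [P, K]
    ring
  have hD' : -m₁ * -m₄ - -m₂ * -m₃ = m₁ * m₄ - m₂ * m₃ := by ring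
  have hamb := integral_fourier_ambiguity_prod Φ G (fun _ => rfl) (L (x, y)) (-X, -Y)
  have hcov := integral_comp_linear_prod_s19 (-m₁) (-m₂) (-m₃) (-m₄) (by rwa [hD']) (fun σ =>
    G (L (x, y) + (2 : ℝ)⁻¹ • σ) * conj (G (L (x, y) - (2 : ℝ)⁻¹ • σ)) *
        cexp ((-(-X * σ.1 + -Y * σ.2) : ℝ) * I))
  rw [hD', hamb, ← mul_assoc] at hcov
  have hr : wigner2D f X Y U V = ∫ t : ℝ × ℝ, Φ (-(-X, -Y) + (2 : ℝ)⁻¹ • t) *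
      conj (Φ (-(-X, -Y) - (2 : ℝ)⁻¹ • t)) *
        cexp ((-((L (x, y)).1 * t.1 + (L (x, y)).2 * t.2) : ℝ) * I) := by
    unfold wigner2D
    congr 1 with t
    have e1 : (-(-X, -Y) + (2 : ℝ)⁻¹ • t : ℝ × ℝ) = (X + t.1 / 2, Y + t.2 / 2) := by
      ext <;> simp <;> ring
    have e2 : (-(-X, -Y) - (2 : ℝ)⁻¹ • t : ℝ × ℝ) = (X - t.1 / 2, Y - t.2 / 2) := by
      ext <;> simp <;> ring
    have e3 := cexp_mul_conj_mul_cexp (P (X + t.1 / 2, Y + t.2 / 2))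
      (P (X - t.1 / 2, Y - t.2 / 2)) (-((L (x, y)).1 * t.1 + (L (x, y)).2 * t.2))
    have e4 : P (X + t.1 / 2, Y + t.2 / 2) - P (X - t.1 / 2, Y - t.2 / 2) +
        -((L (x, y)).1 * t.1 + (L (x, y)).2 * t.2) = -(U * t.1 + V * t.2) := by
      simp only [P, L]
      linear_combination t.1 * hU + t.2 * hV
    have e5 : -I * ((U * t.1 + V * t.2 : ℝ) : ℂ) = ((-(U * t.1 + V * t.2) : ℝ) : ℂ) * I := by
      push_cast; ring
    rw [e4] at e3
    rw [e1, e2, e5, ← e3, hΦ, hΦ]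
    simp only [map_mul]
    ring
  refine (Eq.trans ?_ (congrArg (fun z => ((‖C‖ ^ 2 : ℝ) : ℂ) * z) hcov)).trans ?_
  · rw [← integral_const_mul]
    unfold wigner2D
    congr 1 with τ
    rw [hgG, hgG]
    have e1 : L (x + τ.1 / 2, y + τ.2 / 2) = L (x, y) + (2 : ℝ)⁻¹ • L τ := by
      ext <;> simp [L] <;> ring
    have e2 : L (x - τ.1 / 2, y - τ.2 / 2) = L (x, y) - (2 : ℝ)⁻¹ • L τ := by
      ext <;> simp [L] <;> ring
    have e3 := cexp_mul_conj_mul_cexp (K (x + τ.1 / 2, y + τ.2 / 2))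
      (K (x - τ.1 / 2, y - τ.2 / 2)) (-(u * τ.1 + v * τ.2))
    have e4 : K (x + τ.1 / 2, y + τ.2 / 2) - K (x - τ.1 / 2, y - τ.2 / 2) +
        -(u * τ.1 + v * τ.2) = -(-X * (L τ).1 + -Y * (L τ).2) := by
      simp only [K, L]
      linear_combination τ.1 * hu + τ.2 * hv
    have e5 : -I * ((u * τ.1 + v * τ.2 : ℝ) : ℂ) = ((-(u * τ.1 + v * τ.2) : ℝ) : ℂ) * I := by
      push_cast; ring
    have e6 : ((‖C‖ ^ 2 : ℝ) : ℂ) = C * conj C := by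
      rw [Complex.mul_conj, Complex.normSq_eq_norm_sq]
    rw [e4] at e3
    rw [e1, e2, e5, e6, ← e3]
    simp only [map_mul, L]
    ring
  · rw [hr, ← mul_assoc, ← ofReal_mul, ← ofReal_mul, mul_left_comm, hC,
      inv_mul_cancel₀ (abs_ne_zero.2 hD), ofReal_one, one_mul]

theorem sq_norm_kernel_const (T : ℝ) :
    ‖1 / (2 * (π : ℂ) * ((-(T : ℂ)) ^ ((1 : ℂ) / 2)))‖ ^ 2 * (4 * π ^ 2) = |T|⁻¹ := by
  have h : ‖(-(T : ℂ)) ^ ((1 : ℂ) / 2)‖ ^ 2 = |T| := by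
    rw [← norm_pow, one_div, Complex.cpow_ofNat_inv_pow, norm_neg, Complex.norm_real,
      Real.norm_eq_abs]
  rw [norm_div, norm_mul, norm_mul, div_pow, mul_pow, h, mul_pow]
  simp only [norm_one, Complex.norm_ofNat, Complex.norm_real, Real.norm_eq_abs, sq_abs]
  field_simp
  norm_num

theorem nsfrft_wigner_rotation (a b c d θ : ℝ)
    (h : a ^ 2 + b ^ 2 + c ^ 2 + d ^ 2 = 1)
    (hT : nsT a b c d θ ≠ 0)
    (f : SchwartzMap (ℝ × ℝ) ℂ) :
    ∀ x y u v : ℝ,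
      wigner2D (fun q => nsfrft a b c d θ (fun p => f p) q.1 q.2) x y u v =
        wigner2D (fun p => f p)
          ((a * Real.cos θ - c * Real.sin θ) * x + ((-b) * Real.cos θ - d * Real.sin θ) * y +
            ((-c) * Real.cos θ - a * Real.sin θ) * u + ((-d) * Real.cos θ - (-b) * Real.sin θ) * v)
          ((b * Real.cos θ - d * Real.sin θ) * x + (a * Real.cos θ - (-c) * Real.sin θ) * y +
            ((-d) * Real.cos θ - b * Real.sin θ) * u + (c * Real.cos θ - a * Real.sin θ) * v)
          ((c * Real.cos θ - (-a) * Real.sin θ) * x + (d * Real.cos θ - b * Real.sin θ) * y +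
            (a * Real.cos θ - c * Real.sin θ) * u + ((-b) * Real.cos θ - d * Real.sin θ) * v)
          ((d * Real.cos θ - (-b) * Real.sin θ) * x + ((-c) * Real.cos θ - (-a) * Real.sin θ) * y +
            (b * Real.cos θ - d * Real.sin θ) * u + (a * Real.cos θ - (-c) * Real.sin θ) * v) := by
  intro x y u v
  have hr := Real.sin_sq_add_cos_sq θ
  have hk := sq_norm_kernel_const (nsT a b c d θ)
  have hTdef : nsT a b c d θ = a ^ 2 * Real.sin θ ^ 2 + b ^ 2 * Real.sin θ ^ 2
    - c ^ 2 * Real.cos θ ^ 2 - d ^ 2 * Real.cos θ ^ 2 := rfl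
  simp only [nsfrft, nsKernel]
  generalize nsT a b c d θ = T at *
  generalize Real.sin θ = s at *
  generalize Real.cos θ = C at *
  have hdet : (-a * s + c * C) / T * ((-a * s - c * C) / T) -
      (b * s + d * C) / T * ((-b * s + d * C) / T) = T⁻¹ := by
    field_simp
    rw [hTdef]
    ring
  refine wigner2D_quadraticPhase f (1 / (2 * (π : ℂ) * ((-(T : ℂ)) ^ ((1 : ℂ) / 2))))
    ((s * C - a * c + b * d) / T) (-(b * c + a * d) / T) ((s * C + a * c - b * d) / T)
    ((-a * s + c * C) / T) ((b * s + d * C) / T) ((-b * s + d * C) / T) ((-a * s - c * C) / T)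
    ((s * C - a * c - b * d) / T) ((b * c - a * d) / T) ((s * C + a * c + b * d) / T)
    (by rw [hdet]; exact inv_ne_zero hT) (by rw [hdet, hk, abs_inv]) _ (fun w => ?_)
    x y u v _ _ _ _ ?_ ?_ ?_ ?_
  · congr 1 with q
    have hTC : (T : ℂ) ≠ 0 := ofReal_ne_zero.2 hT
    congr 4
    · congr 1
      push_cast
      field_simp
    · push_cast
      field_simp
    · push_cast
      field_simp
  · field_simp
    rw [hTdef]
    linear_combination x * (-s * C * h + (a * c + b * d) * hr) + y * (a * d - b * c) * hr
  · field_simp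
    rw [hTdef]
    linear_combination x * (a * d - b * c) * hr + y * (-s * C * h - (a * c + b * d) * hr)
  · field_simp
    rw [hTdef]
    linear_combination
      (x * a - y * b) * s * ((1 - c ^ 2 - d ^ 2) * hr + s ^ 2 * h) +
      (x * c + y * d) * C * ((a ^ 2 + b ^ 2 - 1) * hr - C ^ 2 * h) +
      (u * a - v * b) * C * (-(c ^ 2 + d ^ 2) * hr + s ^ 2 * h) +
      (u * c + v * d) * s * (-(a ^ 2 + b ^ 2) * hr + C ^ 2 * h)
  · field_simp
    rw [hTdef]
    linear_combination
      (x * b + y * a) * s * ((1 - c ^ 2 - d ^ 2) * hr + s ^ 2 * h) +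
      (x * d - y * c) * C * ((a ^ 2 + b ^ 2 - 1) * hr - C ^ 2 * h) +
      (u * b + v * a) * C * (-(c ^ 2 + d ^ 2) * hr + s ^ 2 * h) +
      (u * d - v * c) * s * (-(a ^ 2 + b ^ 2) * hr + C ^ 2 * h)
end
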